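/- Let $1<p<2$, $1/p+1/q=1$, $\sigma\in L_p[0,1]$, $d>0$, and let $(\mu_n)_{n\ge1}$ be complex numbers of the form $\mu_n=\pi n+\tilde\mu_n$ with $(\tilde\mu_n)\in\ell_q$ and $|\mathrm{Im}\,\mu_n|\le d$. Then $\sup_{x\in[0,1]}\sum_{n=1}^\infty\left|\int_0^x e^{2i\mu_n t}\sigma(t)\,dt\right|^q<\infty$. -/

import Mathlib

open MeasureTheory intervalIntegral Complex

/-- Weak-type estimate: the part of `f` above a suitable height contributes at most `l / 2`
to each coefficient, and the remaining part is controlled by Bessel's inequality. -/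
theorem count_lt_norm_coeff_le {α : Type*} [MeasurableSpace α] {ν : Measure α} [IsFiniteMeasure ν]
    {e : ℤ → α → ℂ} (he_meas : ∀ n, Measurable (e n)) (he : ∀ n t, ‖e n t‖ ≤ 1)
    (bessel : ∀ g : α → ℂ, MemLp g 2 ν →
      ∑' n, ‖∫ t, e n t * g t ∂ν‖ₑ ^ 2 ≤ ∫⁻ t, ‖g t‖ₑ ^ 2 ∂ν)
    {p A l : ℝ} (hp : 1 < p) {f : α → ℂ} (hf_meas : Measurable f)
    (hf : Integrable (fun t => ‖f t‖ ^ p) ν) (hA : ∫ t, ‖f t‖ ^ p ∂ν ≤ A) (hA0 : 0 < A)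
    (hl : 0 < l) :
    Measure.count {n : ℤ | l < ‖∫ t, e n t * f t ∂ν‖} ≤
      ENNReal.ofReal (4 / l ^ 2) *
        ∫⁻ t in {t | ‖f t‖ ^ (p - 1) * l ≤ 2 * A}, ‖f t‖ₑ ^ 2 ∂ν := by
  set E : Set α := {t | ‖f t‖ ^ (p - 1) * l ≤ 2 * A}
  have hEm : MeasurableSet E :=
    measurableSet_le ((hf_meas.norm.pow_const _).mul_const _) measurable_const
  have hfE : MemLp (E.indicator f) 2 ν := by
    refine MemLp.of_bound (hf_meas.indicator hEm).aestronglyMeasurable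
      ((2 * A / l) ^ (p - 1)⁻¹) (ae_of_all _ fun t => ?_)
    by_cases ht : t ∈ E
    · rw [Set.indicator_of_mem ht, Real.le_rpow_inv_iff_of_pos (norm_nonneg _) (by positivity)
        (by linarith), le_div_iff₀ hl]
      exact ht
    · rw [Set.indicator_of_notMem ht, norm_zero]
      positivity
  have hhigh : ∀ t, ‖Eᶜ.indicator f t‖ ≤ ‖f t‖ ^ p * (l / (2 * A)) := by
    intro t
    by_cases ht : t ∈ E
    · rw [Set.indicator_of_notMem (by simpa using ht), norm_zero]
      positivity
    · rw [Set.indicator_of_mem (by simpa using ht)]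
      have h : 2 * A < ‖f t‖ ^ (p - 1) * l := not_le.mp ht
      have hft : 0 < ‖f t‖ := by
        rcases (norm_nonneg (f t)).eq_or_lt with h0 | h0
        · rw [← h0, Real.zero_rpow (by linarith)] at h
          linarith
        · exact h0
      have hpow : ‖f t‖ ^ p = ‖f t‖ ^ (p - 1) * ‖f t‖ := by
        rw [← Real.rpow_add_one hft.ne', sub_add_cancel]
      rw [hpow, mul_div_assoc', le_div_iff₀ (by positivity)]
      nlinarith
  have hhigh_int : Integrable (Eᶜ.indicator f) ν :=
    (hf.mul_const (l / (2 * A))).mono' (hf_meas.indicator hEm.compl).aestronglyMeasurable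
      (ae_of_all _ hhigh)
  have hlow_int : Integrable (E.indicator f) ν := hfE.integrable (by norm_num)
  have hmul : ∀ n, ∀ g : α → ℂ, Integrable g ν → Integrable (fun t => e n t * g t) ν := by
    intro n g hg
    exact hg.bdd_mul (he_meas n).aestronglyMeasurable (ae_of_all _ (he n))
  have hhigh_coeff : ∀ n, ‖∫ t, e n t * Eᶜ.indicator f t ∂ν‖ ≤ l / 2 := by
    intro n
    calc ‖∫ t, e n t * Eᶜ.indicator f t ∂ν‖
        ≤ ∫ t, ‖f t‖ ^ p * (l / (2 * A)) ∂ν := by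
          refine norm_integral_le_of_norm_le (hf.mul_const _) (ae_of_all _ fun t => ?_)
          rw [norm_mul]
          exact (mul_le_of_le_one_left (norm_nonneg _) (he n t)).trans (hhigh t)
      _ = (∫ t, ‖f t‖ ^ p ∂ν) * (l / (2 * A)) := integral_mul_const _ _
      _ ≤ A * (l / (2 * A)) := by gcongr
      _ = l / 2 := by field_simp
  have hsplit : ∀ n, ∫ t, e n t * f t ∂ν =
      (∫ t, e n t * E.indicator f t ∂ν) + ∫ t, e n t * Eᶜ.indicator f t ∂ν := by
    intro n
    rw [← integral_add (hmul n _ hlow_int) (hmul n _ hhigh_int)]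
    refine integral_congr_ae (ae_of_all _ fun t => ?_)
    simp only [← mul_add]
    rw [← Pi.add_apply, Set.indicator_self_add_compl]
  have hsub : {n : ℤ | l < ‖∫ t, e n t * f t ∂ν‖} ⊆
      {n : ℤ | ENNReal.ofReal (l ^ 2 / 4) ≤ ‖∫ t, e n t * E.indicator f t ∂ν‖ₑ ^ 2} := by
    intro n hn
    simp only [Set.mem_ofPred_eq] at hn ⊢
    rw [hsplit n] at hn
    have h1 := norm_add_le (∫ t, e n t * E.indicator f t ∂ν) (∫ t, e n t * Eᶜ.indicator f t ∂ν)
    have h2 := hhigh_coeff n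
    rw [← ofReal_norm, ← ENNReal.ofReal_pow (norm_nonneg _)]
    apply ENNReal.ofReal_le_ofReal
    nlinarith
  have hmarkov := mul_meas_ge_le_lintegral (μ := (Measure.count : Measure ℤ))
    (f := fun n : ℤ => ‖∫ t, e n t * E.indicator f t ∂ν‖ₑ ^ 2) (measurable_of_countable _)
    (ENNReal.ofReal (l ^ 2 / 4))
  rw [lintegral_count] at hmarkov
  have hL2 : ∫⁻ t, ‖E.indicator f t‖ₑ ^ 2 ∂ν = ∫⁻ t in E, ‖f t‖ₑ ^ 2 ∂ν := by
    rw [← lintegral_indicator hEm]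
    congr 1 with t
    by_cases ht : t ∈ E <;> simp [ht]
  have hinv : ENNReal.ofReal (4 / l ^ 2) = (ENNReal.ofReal (l ^ 2 / 4))⁻¹ := by
    rw [← ENNReal.ofReal_inv_of_pos (by positivity), inv_div]
  rw [hinv, ← ENNReal.div_eq_inv_mul, ENNReal.le_div_iff_mul_le (by left; simpa using by positivity)
    (by left; simp), mul_comm]
  calc _ ≤ _ := mul_le_mul_right (measure_mono hsub) _
    _ ≤ _ := hmarkov
    _ ≤ _ := bessel _ hfE
    _ = _ := hL2

/-- **Hausdorff–Young inequality** for a uniformly bounded system satisfying Bessel's inequality,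
proved by real interpolation. -/
theorem lintegral_norm_coeff_rpow_le {α : Type*} [MeasurableSpace α] {ν : Measure α}
    [IsFiniteMeasure ν]
    {e : ℤ → α → ℂ} (he_meas : ∀ n, Measurable (e n)) (he : ∀ n t, ‖e n t‖ ≤ 1)
    (bessel : ∀ g : α → ℂ, MemLp g 2 ν →
      ∑' n, ‖∫ t, e n t * g t ∂ν‖ₑ ^ 2 ≤ ∫⁻ t, ‖g t‖ₑ ^ 2 ∂ν)
    {p q A : ℝ} (hpq : p.HolderConjugate q) (hp : p < 2) {f : α → ℂ} (hf_meas : Measurable f)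
    (hf : Integrable (fun t => ‖f t‖ ^ p) ν) (hA : ∫ t, ‖f t‖ ^ p ∂ν ≤ A) (hA0 : 0 < A) :
    ∑' n : ℤ, ENNReal.ofReal (‖∫ t, e n t * f t ∂ν‖ ^ q) ≤
      ENNReal.ofReal (q * (4 * (2 * A) ^ (q - 2) / (q - 2) * A)) := by
  have hp1 := hpq.lt
  have hprod : p * q = p + q := hpq.mul_eq_add
  have hq : 2 < q := by nlinarith
  have hinner : ∀ t, ∫⁻ l in Set.Ioi (0 : ℝ),
      {l : ℝ | ‖f t‖ ^ (p - 1) * l ≤ 2 * A}.indicator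
        (fun l => ENNReal.ofReal (4 * l ^ (q - 3)) * ‖f t‖ₑ ^ 2) l ≤
      ENNReal.ofReal (4 * (2 * A) ^ (q - 2) / (q - 2) * ‖f t‖ ^ p) := by
    intro t
    by_cases h0 : f t = 0
    · simp [h0]
    have hpos : 0 < ‖f t‖ := norm_pos_iff.mpr h0
    set b : ℝ := 2 * A / ‖f t‖ ^ (p - 1) with hb
    have hb0 : 0 < b := by positivity
    have hset : {l : ℝ | ‖f t‖ ^ (p - 1) * l ≤ 2 * A} = Set.Iic b := by
      ext l
      simp only [Set.mem_ofPred_eq, Set.mem_Iic, hb]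
      rw [le_div_iff₀ (by positivity), mul_comm]
    have hint : ∫⁻ l in Set.Ioc 0 b, ENNReal.ofReal (4 * l ^ (q - 3)) =
        ENNReal.ofReal (4 * (b ^ (q - 2) / (q - 2))) := by
      have hii : IntervalIntegrable (fun l : ℝ => 4 * l ^ (q - 3)) volume 0 b :=
        (intervalIntegrable_rpow' (by linarith)).const_mul 4
      rw [← ofReal_integral_eq_lintegral_ofReal
        ((intervalIntegrable_iff_integrableOn_Ioc_of_le hb0.le).mp hii)
        ((ae_restrict_iff' measurableSet_Ioc).mpr (ae_of_all _ fun l hl => ?_)),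
        ← intervalIntegral.integral_of_le hb0.le, intervalIntegral.integral_const_mul,
        integral_rpow (Or.inl (by linarith)), Real.zero_rpow (by linarith)]
      · congr 3
        · rw [sub_zero]
          congr 1
          ring
        · ring
      · have := hl.1
        simp only [Pi.zero_apply]
        positivity
    rw [hset, lintegral_indicator measurableSet_Iic, Measure.restrict_restrict measurableSet_Iic,
      Set.inter_comm, Set.Ioi_inter_Iic, lintegral_mul_const _ (by fun_prop), hint,
      ← ofReal_norm, ← ENNReal.ofReal_pow hpos.le, ← ENNReal.ofReal_mul (by
        have : 0 < q - 2 := by linarith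
        positivity)]
    apply ENNReal.ofReal_le_ofReal
    have hexp : (‖f t‖ ^ (p - 1)) ^ (q - 2) * ‖f t‖ ^ p = ‖f t‖ ^ 2 := by
      rw [← Real.rpow_mul hpos.le, ← Real.rpow_add hpos, ← Real.rpow_natCast]
      congr 1
      push_cast
      linarith
    rw [hb, Real.div_rpow (by positivity) (by positivity), ← hexp]
    have : 0 < q - 2 := by linarith
    have : 0 < (‖f t‖ ^ (p - 1)) ^ (q - 2) := by positivity
    apply le_of_eq
    field_simp
  calc ∑' n : ℤ, ENNReal.ofReal (‖∫ t, e n t * f t ∂ν‖ ^ q)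
      = ∫⁻ n, ENNReal.ofReal (‖∫ t, e n t * f t ∂ν‖ ^ q) ∂(Measure.count : Measure ℤ) :=
        (lintegral_count _).symm
    _ = ENNReal.ofReal q * ∫⁻ l in Set.Ioi (0 : ℝ),
          Measure.count {n : ℤ | l < ‖∫ t, e n t * f t ∂ν‖} * ENNReal.ofReal (l ^ (q - 1)) :=
        lintegral_rpow_eq_lintegral_meas_lt_mul _ (ae_of_all _ fun n => norm_nonneg _)
          (measurable_of_countable _).aemeasurable (by linarith)
    _ ≤ ENNReal.ofReal q * ∫⁻ l in Set.Ioi (0 : ℝ), ∫⁻ t,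
          {l : ℝ | ‖f t‖ ^ (p - 1) * l ≤ 2 * A}.indicator
            (fun l => ENNReal.ofReal (4 * l ^ (q - 3)) * ‖f t‖ₑ ^ 2) l ∂ν := by
        refine mul_le_mul_right (setLIntegral_mono' measurableSet_Ioi fun l hl => ?_) _
        have hl : 0 < l := hl
        have hEm : MeasurableSet {t | ‖f t‖ ^ (p - 1) * l ≤ 2 * A} :=
          measurableSet_le ((hf_meas.norm.pow_const _).mul_const _) measurable_const
        refine (mul_le_mul_left (count_lt_norm_coeff_le he_meas he bessel hp1 hf_meas hf hA hA0 hl)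
          _).trans ?_
        rw [mul_right_comm, ← ENNReal.ofReal_mul (by positivity),
          ← lintegral_const_mul _ (by fun_prop), ← lintegral_indicator hEm]
        have hpow : 4 / l ^ 2 * l ^ (q - 1) = 4 * l ^ (q - 3) := by
          rw [show q - 1 = (q - 3) + (2 : ℕ) by push_cast; ring, Real.rpow_add_natCast hl.ne']
          field_simp
        rw [hpow]
        refine lintegral_mono fun t => ?_
        simp only [Set.indicator_apply, Set.mem_ofPred_eq]
        exact le_rfl
    _ = ENNReal.ofReal q * ∫⁻ t, (∫⁻ l in Set.Ioi (0 : ℝ),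
          {l : ℝ | ‖f t‖ ^ (p - 1) * l ≤ 2 * A}.indicator
            (fun l => ENNReal.ofReal (4 * l ^ (q - 3)) * ‖f t‖ₑ ^ 2) l) ∂ν := by
        congr 1
        refine lintegral_lintegral_swap (Measurable.aemeasurable ?_)
        have hS : MeasurableSet {z : ℝ × α | ‖f z.2‖ ^ (p - 1) * z.1 ≤ 2 * A} :=
          measurableSet_le (by fun_prop) measurable_const
        exact Measurable.indicator
          (f := fun z : ℝ × α => ENNReal.ofReal (4 * z.1 ^ (q - 3)) * ‖f z.2‖ₑ ^ 2)
          (by fun_prop) hS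
    _ ≤ ENNReal.ofReal q *
          ∫⁻ t, ENNReal.ofReal (4 * (2 * A) ^ (q - 2) / (q - 2) * ‖f t‖ ^ p) ∂ν :=
        mul_le_mul_right (lintegral_mono hinner) _
    _ = ENNReal.ofReal (q * (4 * (2 * A) ^ (q - 2) / (q - 2) * ∫ t, ‖f t‖ ^ p ∂ν)) := by
        have : 0 < q - 2 := by linarith
        rw [← ofReal_integral_eq_lintegral_ofReal (hf.const_mul _)
          (ae_of_all _ fun t => by simp only [Pi.zero_apply]; positivity),
          MeasureTheory.integral_const_mul,
          ← ENNReal.ofReal_mul (by linarith)]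
    _ ≤ _ := by
        have : 0 < q - 2 := by linarith
        gcongr

/-- Bessel's inequality for the exponentials `exp (2πint)` on `(0, 1]`. -/
theorem tsum_enorm_integral_exp_mul_sq_le {g : ℝ → ℂ}
    (hg : MemLp g 2 (volume.restrict (Set.Ioc 0 1))) :
    ∑' n : ℤ, ‖∫ t in Set.Ioc (0 : ℝ) 1, exp (2 * Real.pi * I * n * t) * g t‖ₑ ^ 2 ≤
      ∫⁻ t in Set.Ioc (0 : ℝ) 1, ‖g t‖ₑ ^ 2 := by
  have h := hasSum_sq_fourierCoeffOn zero_lt_one hg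
  have hcoeff : ∀ n : ℤ, ∫ t in Set.Ioc (0 : ℝ) 1, exp (2 * Real.pi * I * n * t) * g t =
      fourierCoeffOn zero_lt_one g (-n) := by
    intro n
    rw [fourierCoeffOn_eq_integral, intervalIntegral.integral_of_le zero_le_one]
    simp
  have hsq : Integrable (fun t => ‖g t‖ ^ 2) (volume.restrict (Set.Ioc 0 1)) :=
    hg.norm.integrable_sq
  simp_rw [hcoeff, ← ofReal_norm, ← ENNReal.ofReal_pow (norm_nonneg _)]
  rw [← ofReal_integral_eq_lintegral_ofReal hsq (ae_of_all _ fun t => by positivity),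
    tsum_comp_neg (fun n => ENNReal.ofReal (‖fourierCoeffOn zero_lt_one g n‖ ^ 2)),
    ← ENNReal.ofReal_tsum_of_nonneg (fun n => by positivity) h.summable, h.tsum_eq,
    intervalIntegral.integral_of_le zero_le_one]
  simp

/-- Partial integrals of `σ` against the perturbed exponentials `exp (2i(πn + z)t)` differ from
those against `exp (2πint)` by at most a multiple of `‖z‖`. -/
theorem norm_integral_exp_mul_le {σ : ℝ → ℂ} (hσ : IntegrableOn σ (Set.Ioc 0 1))
    {x R : ℝ} (hx : x ∈ Set.Icc (0 : ℝ) 1) (n : ℤ) {z : ℂ} (hz : ‖z‖ ≤ R) :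
    ‖∫ t in (0 : ℝ)..x, exp (2 * I * (Real.pi * n + z) * t) * σ t‖ ≤
      ‖∫ t in Set.Ioc (0 : ℝ) 1, exp (2 * Real.pi * I * n * t) * (Set.Ioc 0 x).indicator σ t‖ +
        2 * Real.exp (2 * R) * (∫ t in Set.Ioc (0 : ℝ) 1, ‖σ t‖) * ‖z‖ := by
  have hsub : Set.Ioc 0 x ⊆ Set.Ioc (0 : ℝ) 1 := Set.Ioc_subset_Ioc_right hx.2
  have hσx : IntegrableOn σ (Set.Ioc 0 x) := hσ.mono_set hsub
  have hdiff : ∀ t ∈ Set.Ioc (0 : ℝ) x,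
      ‖(exp (2 * I * (Real.pi * n + z) * t) - exp (2 * Real.pi * I * n * t)) * σ t‖ ≤
        2 * Real.exp (2 * R) * ‖z‖ * ‖σ t‖ := by
    intro t ht
    have ht1 : t ≤ 1 := ht.2.trans hx.2
    have hzt : ‖2 * I * z * t‖ ≤ 2 * ‖z‖ := by
      simp only [norm_mul, norm_I, Complex.norm_real, Real.norm_of_nonneg ht.1.le, mul_one,
        Complex.norm_ofNat]
      exact mul_le_of_le_one_right (by positivity) ht1
    have hfac : exp (2 * I * (Real.pi * n + z) * t) - exp (2 * Real.pi * I * n * t) =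
        exp ((2 * Real.pi * n * t : ℝ) * I) * (exp (2 * I * z * t) - 1) := by
      rw [mul_sub, ← exp_add, mul_one]
      push_cast
      ring_nf
    have hexp := norm_exp_sub_sum_le_norm_mul_exp (2 * I * z * t) 1
    simp only [Finset.range_one, Finset.sum_singleton, pow_zero, Nat.factorial_zero, Nat.cast_one,
      div_one, pow_one] at hexp
    rw [norm_mul, hfac, norm_mul, norm_exp_ofReal_mul_I, one_mul]
    refine mul_le_mul_of_nonneg_right (hexp.trans ?_) (norm_nonneg _)
    calc ‖2 * I * z * t‖ * Real.exp ‖2 * I * z * t‖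
        ≤ 2 * ‖z‖ * Real.exp (2 * R) := by
          gcongr
          linarith
      _ = 2 * Real.exp (2 * R) * ‖z‖ := by ring
  have hint : ∀ w : ℂ, IntegrableOn (fun t : ℝ => exp (w * t) * σ t) (Set.Ioc 0 x) := by
    intro w
    rw [← intervalIntegrable_iff_integrableOn_Ioc_of_le hx.1] at hσx ⊢
    exact hσx.continuousOn_mul (by fun_prop)
  have hmain : ∫ t in Set.Ioc (0 : ℝ) 1,
      exp (2 * Real.pi * I * n * t) * (Set.Ioc 0 x).indicator σ t =
        ∫ t in Set.Ioc 0 x, exp (2 * Real.pi * I * n * t) * σ t := by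
    simp_rw [← Set.indicator_mul_right _ (fun t : ℝ => exp (2 * Real.pi * I * n * t)) σ]
    rw [setIntegral_indicator measurableSet_Ioc, Set.inter_eq_right.mpr hsub]
  have hrest : ‖∫ t in Set.Ioc 0 x,
      (exp (2 * I * (Real.pi * n + z) * t) - exp (2 * Real.pi * I * n * t)) * σ t‖ ≤
        2 * Real.exp (2 * R) * (∫ t in Set.Ioc (0 : ℝ) 1, ‖σ t‖) * ‖z‖ := by
    calc _ ≤ ∫ t in Set.Ioc 0 x, 2 * Real.exp (2 * R) * ‖z‖ * ‖σ t‖ :=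
          norm_integral_le_of_norm_le (hσx.norm.const_mul _)
            ((ae_restrict_iff' measurableSet_Ioc).mpr (ae_of_all _ hdiff))
      _ = 2 * Real.exp (2 * R) * ‖z‖ * ∫ t in Set.Ioc 0 x, ‖σ t‖ :=
          MeasureTheory.integral_const_mul _ _
      _ ≤ 2 * Real.exp (2 * R) * ‖z‖ * ∫ t in Set.Ioc (0 : ℝ) 1, ‖σ t‖ := by
          refine mul_le_mul_of_nonneg_left ?_ (by positivity)
          exact setIntegral_mono_set hσ.norm (ae_of_all _ fun t => norm_nonneg _)
            hsub.eventuallyLE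
      _ = _ := by ring
  rw [intervalIntegral.integral_of_le hx.1, hmain]
  have hsplit : ∫ t in Set.Ioc 0 x, exp (2 * I * (Real.pi * n + z) * t) * σ t =
      (∫ t in Set.Ioc 0 x, exp (2 * Real.pi * I * n * t) * σ t) +
        ∫ t in Set.Ioc 0 x,
          (exp (2 * I * (Real.pi * n + z) * t) - exp (2 * Real.pi * I * n * t)) * σ t := by
    simp_rw [sub_mul]
    rw [MeasureTheory.integral_sub (hint _) (hint _), add_sub_cancel]
  rw [hsplit]
  exact (norm_add_le _ _).trans (by gcongr)

theorem add_rpow_le_mul_rpow_add_rpow {a b q : ℝ} (ha : 0 ≤ a) (hb : 0 ≤ b) (hq : 1 ≤ q) :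
    (a + b) ^ q ≤ 2 ^ (q - 1) * (a ^ q + b ^ q) := by
  lift a to NNReal using ha
  lift b to NNReal using hb
  exact_mod_cast NNReal.rpow_add_le_mul_rpow_add_rpow a b hq

/-- Uniform Hausdorff–Young bound for the partial integrals of `σ` on `[0, 1]`. -/
theorem exists_forall_tsum_norm_integral_rpow_le {p q : ℝ} (hpq : p.HolderConjugate q)
    (hp : p < 2) {σ : ℝ → ℂ} (hmσ : Measurable σ)
    (hσ : IntegrableOn (fun t => ‖σ t‖ ^ p) (Set.Ioc 0 1)) :
    ∃ B : ℝ, ∀ x : ℝ,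
      Summable (fun n : ℕ => ‖∫ t in Set.Ioc (0 : ℝ) 1,
        exp (2 * Real.pi * I * (n : ℤ) * t) * (Set.Ioc 0 x).indicator σ t‖ ^ q) ∧
      ∑' n : ℕ, ‖∫ t in Set.Ioc (0 : ℝ) 1,
        exp (2 * Real.pi * I * (n : ℤ) * t) * (Set.Ioc 0 x).indicator σ t‖ ^ q ≤ B := by
  have hp0 : 0 < p := hpq.pos
  have hq : 2 < q := by nlinarith [hpq.lt, hpq.mul_eq_add]
  set A : ℝ := (∫ t in Set.Ioc (0 : ℝ) 1, ‖σ t‖ ^ p) + 1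
  have hnn : 0 ≤ ∫ t in Set.Ioc (0 : ℝ) 1, ‖σ t‖ ^ p := by positivity
  have hA0 : 0 < A := by positivity
  refine ⟨q * (4 * (2 * A) ^ (q - 2) / (q - 2) * A), fun x => ?_⟩
  have hmx : Measurable ((Set.Ioc 0 x).indicator σ) := hmσ.indicator measurableSet_Ioc
  have hle : ∀ t, ‖(Set.Ioc 0 x).indicator σ t‖ ^ p ≤ ‖σ t‖ ^ p := fun t =>
    Real.rpow_le_rpow (norm_nonneg _) (norm_indicator_le_norm_self _ _) hp0.le
  have hintx : IntegrableOn (fun t => ‖(Set.Ioc 0 x).indicator σ t‖ ^ p) (Set.Ioc 0 1) := by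
    refine hσ.mono' (hmx.norm.pow_const _).aestronglyMeasurable (ae_of_all _ fun t => ?_)
    rw [Real.norm_of_nonneg (by positivity)]
    exact hle t
  have hAx : ∫ t in Set.Ioc (0 : ℝ) 1, ‖(Set.Ioc 0 x).indicator σ t‖ ^ p ≤ A :=
    (integral_mono hintx hσ hle).trans (by linarith)
  have hHY := lintegral_norm_coeff_rpow_le
    (e := fun (n : ℤ) (t : ℝ) => exp (2 * Real.pi * I * n * t)) (fun n => by fun_prop)
    (fun n t => by
      rw [show (2 * Real.pi * I * n * t : ℂ) = (2 * Real.pi * n * t : ℝ) * I by push_cast; ring,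
        norm_exp_ofReal_mul_I])
    (fun g hg => tsum_enorm_integral_exp_mul_sq_le hg) hpq hp hmx hintx hAx hA0
  have hN := (ENNReal.tsum_comp_le_tsum_of_injective Nat.cast_injective _).trans hHY
  have hnonneg : ∀ n : ℕ, 0 ≤ ‖∫ t in Set.Ioc (0 : ℝ) 1,
        exp (2 * Real.pi * I * (n : ℤ) * t) * (Set.Ioc 0 x).indicator σ t‖ ^ q :=
    fun n => by positivity
  have hsum := ENNReal.summable_toReal (ne_top_of_le_ne_top ENNReal.ofReal_ne_top hN)
  simp only [ENNReal.toReal_ofReal (hnonneg _)] at hsum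
  refine ⟨hsum, ?_⟩
  have : 0 < q - 2 := by linarith
  rw [← ENNReal.ofReal_le_ofReal_iff (by positivity), ENNReal.ofReal_tsum_of_nonneg hnonneg hsum]
  exact hN

/-- if `μₙ = πn + μ̃ₙ` with `(μ̃ₙ) ∈ ℓ_q`, `|Im μₙ| ≤ d`, and
`σ ∈ L_p[0,1]`, `1 < p < 2`, `1/p + 1/q = 1`, then
`sup_{x∈[0,1]} ∑ₙ |∫_0^x e^{2iμₙ t} σ(t) dt|^q < ∞`. -/
theorem stmt9 (p q : ℝ) (hp1 : 1 < p) (hp2 : p < 2) (hpq : 1/p + 1/q = 1)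
    (σ : ℝ → ℂ) (hmσ : Measurable σ)
    (hσ : IntervalIntegrable (fun t => ‖σ t‖ ^ p) volume 0 1)
    (d : ℝ) (hd : 0 < d) (μ μt : ℕ → ℂ)
    (hform : ∀ n : ℕ, 1 ≤ n → μ n = (Real.pi * n : ℝ) + μt n)
    (hlq : Summable (fun n : ℕ => ‖μt n‖ ^ q))
    (hstripe : ∀ n : ℕ, 1 ≤ n → |(μ n).im| ≤ d) :
    ∃ M : ℝ, ∀ x ∈ Set.Icc (0:ℝ) 1,
      Summable (fun n : ℕ =>
        ‖∫ t in (0:ℝ)..x, Complex.exp (2 * I * μ n * t) * σ t‖ ^ q) ∧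
      (∑' n : ℕ, ‖∫ t in (0:ℝ)..x, Complex.exp (2 * I * μ n * t) * σ t‖ ^ q) ≤ M := by
  have hconj : p.HolderConjugate q :=
    Real.holderConjugate_iff.mpr ⟨hp1, by simpa only [one_div] using hpq⟩
  have hq1 : 1 < q := hconj.symm.lt
  have hq0 : 0 < q := by linarith
  have hσp : IntegrableOn (fun t => ‖σ t‖ ^ p) (Set.Ioc 0 1) :=
    (intervalIntegrable_iff_integrableOn_Ioc_of_le zero_le_one).mp hσ
  have hσ1 : IntegrableOn σ (Set.Ioc 0 1) := by
    refine (hσp.add (integrable_const (1 : ℝ))).mono' hmσ.aestronglyMeasurable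
      (ae_of_all _ fun t => ?_)
    rcases le_total ‖σ t‖ 1 with h | h
    · have : 0 ≤ ‖σ t‖ ^ p := by positivity
      simp only [Pi.add_apply]
      linarith
    · have := Real.self_le_rpow_of_one_le h hp1.le
      simp only [Pi.add_apply]
      linarith
  obtain ⟨ν, hν⟩ : ∃ ν : ℕ → ℂ, ∀ n, μ n = Real.pi * (n : ℤ) + ν n :=
    ⟨fun n => μ n - Real.pi * (n : ℤ), fun n => by ring⟩
  have hνsum : Summable (fun n => ‖ν n‖ ^ q) := by
    rw [← summable_nat_add_iff 1] at hlq ⊢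
    refine hlq.congr fun n => ?_
    have h := hform (n + 1) (by omega)
    rw [hν] at h
    push_cast at h
    rw [add_left_cancel h]
  set R : ℝ := (∑' n, ‖ν n‖ ^ q) ^ q⁻¹
  have hR : ∀ n, ‖ν n‖ ≤ R := by
    intro n
    rw [Real.le_rpow_inv_iff_of_pos (norm_nonneg _) (by positivity) hq0]
    exact hνsum.le_tsum n fun m _ => by positivity
  obtain ⟨B, hB⟩ := exists_forall_tsum_norm_integral_rpow_le hconj hp2 hmσ hσp
  set C : ℝ := 2 * Real.exp (2 * R) * ∫ t in Set.Ioc (0 : ℝ) 1, ‖σ t‖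
  have hC : 0 ≤ C := by positivity
  refine ⟨2 ^ (q - 1) * (B + C ^ q * ∑' n, ‖ν n‖ ^ q), fun x hx => ?_⟩
  obtain ⟨hBs, hBle⟩ := hB x
  have hterm : ∀ n : ℕ, ‖∫ t in (0:ℝ)..x, Complex.exp (2 * I * μ n * t) * σ t‖ ^ q ≤
      2 ^ (q - 1) * (‖∫ t in Set.Ioc (0 : ℝ) 1,
        exp (2 * Real.pi * I * (n : ℤ) * t) * (Set.Ioc 0 x).indicator σ t‖ ^ q +
          C ^ q * ‖ν n‖ ^ q) := by
    intro n
    have h := norm_integral_exp_mul_le hσ1 hx n (hR n)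
    rw [← hν n] at h
    refine (Real.rpow_le_rpow (norm_nonneg _) h hq0.le).trans ?_
    rw [← Real.mul_rpow hC (norm_nonneg _)]
    exact add_rpow_le_mul_rpow_add_rpow (norm_nonneg _) (by positivity) hq1.le
  have hdom := (hBs.add (hνsum.mul_left (C ^ q))).mul_left ((2 : ℝ) ^ (q - 1))
  have hsum := hdom.of_nonneg_of_le (fun n => by positivity) hterm
  refine ⟨hsum, (hsum.tsum_le_tsum hterm hdom).trans ?_⟩
  rw [tsum_mul_left, hBs.tsum_add (hνsum.mul_left _), tsum_mul_left]
  gcongr
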